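/- arXiv:1701.01515 — 2 statements merged into one kernel-verified Lean document; each statement's English description precedes it below -/
import Mathlib

section
/- For every α ∈ (1,2), the function ν is differentiable at α and its derivative satisfies ν′(α) < −(π/4)·σ^α·sin(απ/2)/cos²(απ/2) < 0. -/
open Real

/-- For `σ ∈ (0,1)` and the FMLS convexity adjustment
`ν(α) = −(1/2)·σ^α / cos(απ/2)`, for every `α ∈ (1,2)` the function `ν` is
differentiable at `α` and
`ν′(α) < −(π/4)·σ^α·sin(απ/2)/cos²(απ/2) < 0`. -/
theorem convexity_adjustment_deriv_neg
    (σ : ℝ) (hσ : σ ∈ Set.Ioo (0 : ℝ) 1)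
    (ν : ℝ → ℝ) (hν : ∀ α : ℝ, ν α = -(1 / 2) * σ ^ α / Real.cos (α * π / 2)) :
    ∀ α ∈ Set.Ioo (1 : ℝ) 2,
      DifferentiableAt ℝ ν α ∧
      deriv ν α < -(π / 4) * σ ^ α * Real.sin (α * π / 2) / (Real.cos (α * π / 2)) ^ 2 ∧
      -(π / 4) * σ ^ α * Real.sin (α * π / 2) / (Real.cos (α * π / 2)) ^ 2 < 0 := by
  obtain ⟨hσ0, hσ1⟩ := hσ
  rintro α ⟨h1, h2⟩
  have hcos : cos (α * π / 2) < 0 :=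
    cos_neg_of_pi_div_two_lt_of_lt (by nlinarith [pi_pos]) (by nlinarith [pi_pos])
  have hsin : 0 < sin (α * π / 2) :=
    sin_pos_of_pos_of_lt_pi (by nlinarith [pi_pos]) (by nlinarith [pi_pos])
  have hpow : 0 < σ ^ α := rpow_pos_of_pos hσ0 α
  have hlog : log σ < 0 := log_neg hσ0 hσ1
  have hderiv : HasDerivAt ν
      (-(π / 4) * σ ^ α * sin (α * π / 2) / cos (α * π / 2) ^ 2
        - 1 / 2 * σ ^ α * (log σ / cos (α * π / 2))) α := by
    have hnum := ((hasDerivAt_id α).const_rpow hσ0).const_mul (-(1 / 2))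
    have hden := (((hasDerivAt_id α).mul_const π).div_const 2).cos
    rw [funext hν]
    refine (hnum.div hden hcos.ne).congr_deriv ?_
    simp only [id]
    field_simp [hcos.ne]
    ring
  refine ⟨hderiv.differentiableAt, ?_, ?_⟩
  · rw [hderiv.deriv]
    have := div_pos_of_neg_of_neg hlog hcos
    exact sub_lt_self _ (by positivity)
  · have : 0 < π / 4 * σ ^ α * sin (α * π / 2) / cos (α * π / 2) ^ 2 :=
      div_pos (by positivity) (sq_pos_of_neg hcos)
    simpa only [neg_mul, neg_div, neg_lt_zero] using this
end

section
/- The function ν is strictly decreasing on the interval (1,2). -/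
open Real

/-- For `σ ∈ (0,1)`, the FMLS convexity adjustment
`ν(α) = −(1/2)·σ^α / cos(απ/2)` is strictly decreasing on `(1,2)`. -/
theorem convexity_adjustment_strictAnti
    (σ : ℝ) (hσ : σ ∈ Set.Ioo (0 : ℝ) 1)
    (ν : ℝ → ℝ) (hν : ∀ α : ℝ, ν α = -(1 / 2) * σ ^ α / Real.cos (α * π / 2)) :
    StrictAntiOn ν (Set.Ioo (1 : ℝ) 2) := by
  rintro a ⟨ha1, ha2⟩ b ⟨hb1, hb2⟩ hab
  have hπ := Real.pi_pos
  have hcos : Real.cos (b * π / 2) < Real.cos (a * π / 2) :=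
    Real.cos_lt_cos_of_nonneg_of_le_pi (by positivity) (by nlinarith) (by nlinarith)
  have hcos_neg : Real.cos (a * π / 2) < 0 :=
    Real.cos_neg_of_pi_div_two_lt_of_lt (by nlinarith) (by nlinarith)
  have hpow : σ ^ b < σ ^ a := Real.rpow_lt_rpow_of_exponent_gt hσ.1 hσ.2 hab
  have hpow_pos : 0 < σ ^ a := Real.rpow_pos_of_pos hσ.1 a
  have hν' (α : ℝ) : ν α = 1 / 2 * σ ^ α / -Real.cos (α * π / 2) := by
    rw [hν, neg_mul, neg_div, div_neg]
  rw [hν', hν']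
  exact div_lt_div₀ (by linarith) (by linarith) (by positivity) (by linarith)
end
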